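/- Let ρ be a smooth function on an open subset of the upper half-space {z > 0}. Then the identity L(zρ) + zρ = z · ( z²(∂²_xρ + ∂²_yρ + ∂²_zρ) + z ∂_zρ ) holds. Consequently, Λ = zρ satisfies the hyperbolic Helmholtz equation L Λ + Λ = 0 if and only if ρ is a circle-invariant harmonic function on Euclidean 4-space, i.e. z²(∂²_xρ + ∂²_yρ + ∂²_zρ) + z ∂_zρ = 0. (This is the equivalence between the JNR construction of hyperbolic monopoles and the Helmholtz-equation construction, with conformal factor Ω = z.) -/

import Mathlib

noncomputable section

/-- Partial derivative in the first upper-half-space coordinate. -/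
def pd1 (f : ℝ → ℝ → ℝ → ℝ) (x y z : ℝ) : ℝ := deriv (fun t => f t y z) x

/-- Partial derivative in the second upper-half-space coordinate. -/
def pd2 (f : ℝ → ℝ → ℝ → ℝ) (x y z : ℝ) : ℝ := deriv (fun t => f x t z) y

/-- Partial derivative in the third upper-half-space coordinate. -/
def pd3 (f : ℝ → ℝ → ℝ → ℝ) (x y z : ℝ) : ℝ := deriv (fun t => f x y t) z

/-- Hyperbolic Laplacian in upper half-space coordinates:
`L f = z²(∂²ₓf + ∂²_yf + ∂²_zf) − z ∂_zf`. -/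
def hypLap (f : ℝ → ℝ → ℝ → ℝ) (x y z : ℝ) : ℝ :=
  z ^ 2 * (pd1 (pd1 f) x y z + pd2 (pd2 f) x y z + pd3 (pd3 f) x y z) - z * pd3 f x y z

theorem deriv_id_mul {g : ℝ → ℝ} {z : ℝ} (hg : DifferentiableAt ℝ g z) :
    deriv (fun t => t * g t) z = g z + z * deriv g z := by
  simpa using (hasDerivAt_id z).fun_mul hg.hasDerivAt |>.deriv

theorem deriv_deriv_id_mul {g : ℝ → ℝ} {z : ℝ} (hg : ContDiffAt ℝ 2 g z) :
    deriv (deriv fun t => t * g t) z = 2 * deriv g z + z * deriv (deriv g) z := by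
  have hev : (deriv fun t => t * g t) =ᶠ[nhds z] fun t => g t + t * deriv g t := by
    filter_upwards [hg.eventually (by simp)] with t ht
    exact deriv_id_mul (ht.differentiableAt (by simp))
  have hd : DifferentiableAt ℝ g z := hg.differentiableAt (by simp)
  have hd' : DifferentiableAt ℝ (deriv g) z :=
    (hg.derivWithin (m := 1) (by norm_num)).differentiableAt (by simp)
  rw [hev.deriv_eq, deriv_fun_add hd (differentiableAt_fun_id.fun_mul hd'), deriv_id_mul hd']
  ring

theorem pd1_pd1_third_mul (ρ : ℝ → ℝ → ℝ → ℝ) (x y z : ℝ) :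
    pd1 (pd1 fun a b c => c * ρ a b c) x y z = z * pd1 (pd1 ρ) x y z := by
  simp only [pd1, deriv_const_mul_field]

theorem pd2_pd2_third_mul (ρ : ℝ → ℝ → ℝ → ℝ) (x y z : ℝ) :
    pd2 (pd2 fun a b c => c * ρ a b c) x y z = z * pd2 (pd2 ρ) x y z := by
  simp only [pd2, deriv_const_mul_field]

theorem hypLap_third_mul_add {ρ : ℝ → ℝ → ℝ → ℝ} {x y z : ℝ}
    (hρ : ContDiffAt ℝ 2 (ρ x y) z) :
    hypLap (fun a b c => c * ρ a b c) x y z + z * ρ x y z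
      = z * (z ^ 2 * (pd1 (pd1 ρ) x y z + pd2 (pd2 ρ) x y z + pd3 (pd3 ρ) x y z)
          + z * pd3 ρ x y z) := by
  have h3 : pd3 (fun a b c => c * ρ a b c) x y z = ρ x y z + z * pd3 ρ x y z :=
    deriv_id_mul (hρ.differentiableAt (by simp))
  have h33 : pd3 (pd3 fun a b c => c * ρ a b c) x y z
      = 2 * pd3 ρ x y z + z * pd3 (pd3 ρ) x y z :=
    deriv_deriv_id_mul hρ
  rw [hypLap, pd1_pd1_third_mul, pd2_pd2_third_mul, h3, h33]
  ring

/-- JNR–Helmholtz equivalence: for smooth `ρ` on an open subset of the upper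
half-space, the identity `L(zρ) + zρ = z(z²Δρ + z∂_zρ)` holds; hence `Λ = zρ`
solves the hyperbolic Helmholtz equation if and only if `ρ` is a circle-invariant
harmonic function on Euclidean 4-space. -/
theorem jnr_helmholtz_equivalence (U : Set (ℝ × ℝ × ℝ)) (hU : IsOpen U)
    (hUz : ∀ q ∈ U, 0 < q.2.2)
    (ρ : ℝ → ℝ → ℝ → ℝ)
    (hρ : ContDiffOn ℝ (⊤ : ℕ∞) (fun q : ℝ × ℝ × ℝ => ρ q.1 q.2.1 q.2.2) U) :
    (∀ q ∈ U, ∀ x y z : ℝ, q = (x, y, z) →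
      hypLap (fun a b c => c * ρ a b c) x y z + z * ρ x y z
        = z * (z ^ 2 * (pd1 (pd1 ρ) x y z + pd2 (pd2 ρ) x y z + pd3 (pd3 ρ) x y z)
            + z * pd3 ρ x y z)) ∧
    ((∀ q ∈ U, hypLap (fun a b c => c * ρ a b c) q.1 q.2.1 q.2.2
        + q.2.2 * ρ q.1 q.2.1 q.2.2 = 0) ↔
     (∀ q ∈ U, q.2.2 ^ 2 * (pd1 (pd1 ρ) q.1 q.2.1 q.2.2 + pd2 (pd2 ρ) q.1 q.2.1 q.2.2
          + pd3 (pd3 ρ) q.1 q.2.1 q.2.2)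
        + q.2.2 * pd3 ρ q.1 q.2.1 q.2.2 = 0)) := by
  have key : ∀ q ∈ U, ∀ x y z : ℝ, q = (x, y, z) →
      hypLap (fun a b c => c * ρ a b c) x y z + z * ρ x y z
        = z * (z ^ 2 * (pd1 (pd1 ρ) x y z + pd2 (pd2 ρ) x y z + pd3 (pd3 ρ) x y z)
            + z * pd3 ρ x y z) := by
    rintro _ hq x y z rfl
    have hslice : ContDiffAt ℝ (⊤ : ℕ∞) (ρ x y) z :=
      (hρ.contDiffAt (hU.mem_nhds hq)).comp (f := fun t : ℝ => (x, y, t)) z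
        (by fun_prop)
    exact hypLap_third_mul_add (hslice.of_le (WithTop.coe_le_coe.2 le_top))
  refine ⟨key, forall₂_congr fun q hq => ?_⟩
  rw [key q hq q.1 q.2.1 q.2.2 rfl, mul_eq_zero, or_iff_right (hUz q hq).ne']
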